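/- Define binary strings by a₀ = 1 and a_{n+1} = aₙ āₙ āₙ aₙ aₙ, where x̄ denotes the bitwise complement of x. Let cₙ be the concatenation of 10 copies of aₙ and let ω = c₀c₁c₂c₃…. Then ω is almost periodic. -/

import Mathlib

/-- The segment of a sequence `ω` of length `l` starting at position `i`,
i.e. the string `ω(i)ω(i+1)…ω(i+l-1)`. -/
def seg {A : Type*} (ω : ℕ → A) (i l : ℕ) : List A :=
  List.ofFn (fun k : Fin l => ω (i + k))

/-- The string `x` occurs in the sequence `ω` starting at position `i`. -/
def OccursAt {A : Type*} (ω : ℕ → A) (x : List A) (i : ℕ) : Prop :=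
  seg ω i x.length = x

/-- A sequence is almost periodic if every string occurring in it infinitely many
times occurs in every segment of some fixed length `l`. -/
def AlmostPeriodic {A : Type*} (ω : ℕ → A) : Prop :=
  ∀ x : List A, (∀ N, ∃ i, N ≤ i ∧ OccursAt ω x i) →
    ∃ l, ∀ i, ∃ j, i ≤ j ∧ j + x.length ≤ i + l ∧ OccursAt ω x j

/-- The bitwise complement of a binary string: every `0` is changed to `1` and vice versa. -/
def bcomp (x : List Bool) : List Bool := x.map (fun b => !b)

/-- The strings `a₀ = 1`, `a_{n+1} = aₙ āₙ āₙ aₙ aₙ`. -/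
def aStr : ℕ → List Bool
  | 0 => [true]
  | n + 1 => aStr n ++ bcomp (aStr n) ++ bcomp (aStr n) ++ aStr n ++ aStr n

/-- The string `cₙ`: the concatenation of 10 copies of `aₙ`. -/
def cStr (n : ℕ) : List Bool := (List.replicate 10 (aStr n)).flatten

/-- The finite prefix `c₀c₁…c_{n-1}` of `ω`; its length is `lₙ = (5/2)(5ⁿ − 1)`. -/
def prefixStr (n : ℕ) : List Bool := (List.ofFn fun k : Fin n => cStr k).flatten

/-- The sequence `ω = c₀c₁c₂c₃…` (the `m`-th symbol lies in the prefix
`c₀…c_m`, which has length greater than `m`). -/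
def omegaSeq (m : ℕ) : Bool := (prefixStr (m + 1)).getD m false

theorem occursAt_iff {A : Type*} {ω : ℕ → A} {x : List A} {i : ℕ} :
    OccursAt ω x i ↔ ∀ k (h : k < x.length), ω (i + k) = x[k] := by
  unfold OccursAt seg
  constructor
  · intro h k hk
    have := List.getElem_of_eq h (i := k) (by simpa using hk)
    simpa using this
  · intro h
    apply List.ext_getElem
    · simp
    · intro k _ hk
      simpa using h k hk

theorem occursAt_append {A : Type*} {ω : ℕ → A} {x y : List A} {i : ℕ} :
    OccursAt ω (x ++ y) i ↔ OccursAt ω x i ∧ OccursAt ω y (i + x.length) := by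
  simp only [occursAt_iff]
  constructor
  · intro h
    refine ⟨fun k hk => ?_, fun k hk => ?_⟩
    · rw [h k (by simp; omega), List.getElem_append_left hk]
    · rw [add_assoc, h (x.length + k) (by simp; omega),
        List.getElem_append_right (by omega)]
      simp
  · rintro ⟨h₁, h₂⟩ k hk
    by_cases hkx : k < x.length
    · rw [List.getElem_append_left hkx, h₁ k hkx]
    · rw [List.getElem_append_right (by omega),
        ← h₂ (k - x.length) (by simp at hk; omega)]
      congr 1
      omega

/-- An occurrence of `x` inside an occurrence of `y` can be transported to
any other occurrence of `y`. -/
theorem OccursAt.transport {A : Type*} {ω : ℕ → A} {x y : List A} {i j r : ℕ}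
    (hi : OccursAt ω y i) (hj : OccursAt ω y j) (hr : r + x.length ≤ y.length)
    (hx : OccursAt ω x (i + r)) : OccursAt ω x (j + r) := by
  rw [occursAt_iff] at *
  intro k hk
  rw [← hx k hk, add_assoc, add_assoc, hi _ (by omega), hj _ (by omega)]

theorem bcomp_append (x y : List Bool) : bcomp (x ++ y) = bcomp x ++ bcomp y := by
  simp [bcomp]

theorem bcomp_bcomp (x : List Bool) : bcomp (bcomp x) = x := by
  simp [bcomp, Function.comp_def]

theorem length_bcomp (x : List Bool) : (bcomp x).length = x.length := by
  simp [bcomp]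

theorem length_aStr (n : ℕ) : (aStr n).length = 5 ^ n := by
  induction n with
  | zero => rfl
  | succ n ih =>
    simp only [aStr, List.length_append, length_bcomp, ih]
    ring

/-- The string `aₙ` or its complement, according to the bit `b`. -/
def block (n : ℕ) (b : Bool) : List Bool := if b then aStr n else bcomp (aStr n)

theorem length_block (n : ℕ) (b : Bool) : (block n b).length = 5 ^ n := by
  cases b <;> simp [block, length_bcomp, length_aStr]

theorem block_succ (n : ℕ) (b : Bool) :
    block (n + 1) b = block n b ++ block n (!b) ++ block n (!b) ++ block n b ++ block n b := by
  cases b <;> simp [block, aStr, bcomp_append, bcomp_bcomp]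

/-- Every pair of blocks of rank `n` occurs in every block of rank `n + 1`. -/
theorem exists_block_succ_eq (n : ℕ) (b c d : Bool) :
    ∃ p s, block (n + 1) b = p ++ (block n c ++ block n d) ++ s := by
  rw [block_succ]
  by_cases hc : c = b <;> by_cases hd : d = b
  · subst hc; subst hd
    exact ⟨block n d ++ block n (!d) ++ block n (!d), [], by simp⟩
  · obtain rfl : d = !b := by cases b <;> cases d <;> simp_all
    subst hc
    exact ⟨[], block n (!c) ++ block n c ++ block n c, by simp⟩
  · obtain rfl : c = !b := by cases b <;> cases c <;> simp_all
    subst hd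
    exact ⟨block n d ++ block n (!d), block n d, by simp⟩
  · obtain rfl : d = !b := by cases b <;> cases d <;> simp_all
    obtain rfl : c = !b := by cases b <;> cases c <;> simp_all
    exact ⟨block n b, block n b ++ block n b, by simp⟩

theorem exists_block_eq_flatMap {n m : ℕ} (h : n ≤ m) (b : Bool) :
    ∃ bs : List Bool, block m b = bs.flatMap (block n) := by
  induction m, h using Nat.le_induction generalizing b with
  | base => exact ⟨[b], by simp⟩
  | succ m _ ih =>
    obtain ⟨u, hu⟩ := ih b
    obtain ⟨v, hv⟩ := ih (!b)
    exact ⟨u ++ v ++ v ++ u ++ u, by simp only [block_succ, hu, hv, List.flatMap_append]⟩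

theorem exists_cStr_eq_flatMap {n m : ℕ} (h : n ≤ m) :
    ∃ bs : List Bool, cStr m = bs.flatMap (block n) := by
  obtain ⟨u, hu⟩ := exists_block_eq_flatMap h true
  have hu : aStr m = u.flatMap (block n) := by simpa [block] using hu
  refine ⟨(List.replicate 10 u).flatten, ?_⟩
  simp [cStr, hu, List.replicate_succ]

theorem prefixStr_succ (n : ℕ) : prefixStr (n + 1) = prefixStr n ++ cStr n := by
  rw [prefixStr, List.ofFn_succ_last]
  simp [prefixStr]

theorem exists_prefixStr_eq_append_flatMap {n m : ℕ} (h : n ≤ m) :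
    ∃ bs : List Bool, prefixStr m = prefixStr n ++ bs.flatMap (block n) := by
  induction m, h using Nat.le_induction with
  | base => exact ⟨[], by simp⟩
  | succ m hm ih =>
    obtain ⟨u, hu⟩ := ih
    obtain ⟨v, hv⟩ := exists_cStr_eq_flatMap hm
    exact ⟨u ++ v, by simp [prefixStr_succ, hu, hv]⟩

theorem le_length_prefixStr (n : ℕ) : n ≤ (prefixStr n).length := by
  induction n with
  | zero => simp
  | succ n ih =>
    have : 0 < 5 ^ n := by positivity
    simp [prefixStr_succ, cStr, length_aStr]
    omega

theorem prefixStr_isPrefix_of_le {n m : ℕ} (h : n ≤ m) : prefixStr n <+: prefixStr m := by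
  obtain ⟨u, hu⟩ := exists_prefixStr_eq_append_flatMap h
  exact ⟨_, hu.symm⟩

theorem occursAt_prefixStr (n : ℕ) : OccursAt omegaSeq (prefixStr n) 0 := by
  rw [occursAt_iff]
  intro k hk
  have hk' : k < (prefixStr (k + 1)).length := le_length_prefixStr (k + 1)
  rw [zero_add, omegaSeq, List.getD_eq_getElem _ _ hk']
  rcases le_total n (k + 1) with h | h
  · exact ((prefixStr_isPrefix_of_le h).getElem hk).symm
  · exact (prefixStr_isPrefix_of_le h).getElem hk'

theorem length_flatMap_block (n : ℕ) (bs : List Bool) :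
    (bs.flatMap (block n)).length = bs.length * 5 ^ n := by
  simp [List.length_flatMap, length_block]

theorem exists_occursAt_of_flatMap {ω : ℕ → Bool} {n : ℕ} {bs : List Bool} {s k : ℕ}
    (h : OccursAt ω (bs.flatMap (block n)) s) (hk : k < bs.length) :
    ∃ b, OccursAt ω (block n b) (s + k * 5 ^ n) := by
  induction bs generalizing s k with
  | nil => simp at hk
  | cons b bs ih =>
    rw [List.flatMap_cons, occursAt_append, length_block] at h
    cases k with
    | zero => exact ⟨b, by simpa using h.1⟩
    | succ k =>
      obtain ⟨c, hc⟩ := ih h.2 (by simpa using hk)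
      refine ⟨c, ?_⟩
      convert hc using 1
      ring

/-- After the prefix `c₀…c_{n-1}`, the sequence `ω` is a concatenation of blocks of rank `n`. -/
theorem exists_occursAt_block (n k : ℕ) :
    ∃ b, OccursAt omegaSeq (block n b) ((prefixStr n).length + k * 5 ^ n) := by
  obtain ⟨bs, hbs⟩ := exists_prefixStr_eq_append_flatMap
    (show n ≤ n + (prefixStr n).length + (k + 1) * 5 ^ n by omega)
  have hlen := le_length_prefixStr (n + (prefixStr n).length + (k + 1) * 5 ^ n)
  have hocc := occursAt_prefixStr (n + (prefixStr n).length + (k + 1) * 5 ^ n)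
  rw [hbs] at hlen hocc
  rw [List.length_append, length_flatMap_block] at hlen
  rw [occursAt_append, zero_add] at hocc
  refine exists_occursAt_of_flatMap hocc.2 ?_
  have : (k + 1) * 5 ^ n ≤ bs.length * 5 ^ n := by omega
  exact Nat.le_of_mul_le_mul_right this (by positivity)

/-- The sequence `ω = c₀c₁c₂c₃…`, where `cₙ` is the concatenation of 10 copies of `aₙ`,
`a₀ = 1` and `a_{n+1} = aₙ āₙ āₙ aₙ aₙ`, is almost periodic. -/
theorem omegaSeq_almostPeriodic : AlmostPeriodic omegaSeq := by
  intro x hx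
  set n := x.length
  have hxn : n < 5 ^ n := Nat.lt_pow_self (by norm_num)
  obtain ⟨i₀, hi₀, hocc⟩ := hx (prefixStr n).length
  set k := (i₀ - (prefixStr n).length) / 5 ^ n
  set r := (i₀ - (prefixStr n).length) % 5 ^ n
  have hrlt : r < 5 ^ n := Nat.mod_lt _ (by positivity)
  have hkr : k * 5 ^ n + r = i₀ - (prefixStr n).length := Nat.div_add_mod' _ _
  obtain ⟨c, hc⟩ := exists_occursAt_block n k
  obtain ⟨d, hd⟩ := exists_occursAt_block n (k + 1)
  have hpair : OccursAt omegaSeq (block n c ++ block n d)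
      ((prefixStr n).length + k * 5 ^ n) := by
    rw [occursAt_append, length_block]
    refine ⟨hc, ?_⟩
    convert hd using 1
    ring
  have hocc' : OccursAt omegaSeq x ((prefixStr n).length + k * 5 ^ n + r) := by
    convert hocc using 1
    omega
  refine ⟨(prefixStr (n + 1)).length + 2 * 5 ^ (n + 1), fun i => ?_⟩
  set q := i / 5 ^ (n + 1)
  have hpos : 0 < 5 ^ (n + 1) := by positivity
  have hqi : q * 5 ^ (n + 1) + i % 5 ^ (n + 1) = i := Nat.div_add_mod' _ _
  have hmod := Nat.mod_lt i hpos
  obtain ⟨b, hb⟩ := exists_occursAt_block (n + 1) (q + 1)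
  obtain ⟨p, s, hps⟩ := exists_block_succ_eq n b c d
  have hlen := length_block (n + 1) b
  rw [hps] at hb hlen
  rw [occursAt_append, occursAt_append] at hb
  simp only [List.length_append, length_block] at hlen
  have hq1 : (q + 1) * 5 ^ (n + 1) = q * 5 ^ (n + 1) + 5 ^ (n + 1) := by ring
  refine ⟨(prefixStr (n + 1)).length + (q + 1) * 5 ^ (n + 1) + p.length + r, ?_, ?_,
    hpair.transport hb.1.2 (by simp only [List.length_append, length_block]; omega) hocc'⟩
  · omega
  · omega
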